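/- Under the conditions of the Cauchy–Born existence theorem (f ∈ 𝒰* with ‖f‖_{𝒰*} < ε_cb, u^cb the strongly stable solution with u^cb ∈ H³_loc), there is a constant C such that for all v ∈ 𝒰, |∫₀^∞ ∂_F W(∇u^cb(x)) ∇v(x) dx − Σ_{ℓ=0}^∞ ∂_F W((Π_a u^cb)'_ℓ) v'_ℓ| ≤ C‖∇²u^cb‖²_{L⁴(0,∞)} ‖v'‖_{ℓ²}, where v is identified with its continuous piecewise affine interpolant (so ∇v ≡ v'_ℓ on (ℓ, ℓ+1)). -/

import Mathlib

open scoped BigOperators ENNReal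
open Filter MeasureTheory

noncomputable section

/-- discrete strain: `u'_ℓ = u_{ℓ+1} - u_ℓ` -/
def du (u : ℕ → ℝ) (ℓ : ℕ) : ℝ := u (ℓ + 1) - u ℓ

/-- second difference of strains: `u''_ℓ = u'_{ℓ+1} - u'_ℓ` -/
def ddu (u : ℕ → ℝ) (ℓ : ℕ) : ℝ := du u (ℓ + 1) - du u ℓ

/-- the displacement space 𝒰 -/
def memU (u : ℕ → ℝ) : Prop := u 0 = 0 ∧ Summable (fun ℓ => (du u ℓ) ^ 2)

/-- ℓ² norm of a sequence -/
def l2 (e : ℕ → ℝ) : ℝ := Real.sqrt (∑' ℓ, (e ℓ) ^ 2)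

/-- compactly supported lattice function -/
def FinSupp (u : ℕ → ℝ) : Prop := ∃ N : ℕ, ∀ ℓ : ℕ, N ≤ ℓ → u ℓ = 0

/-- membership in the dual space 𝒰* -/
def memUstar (f : ℕ → ℝ) : Prop :=
  ∃ M : ℝ, ∀ u : ℕ → ℝ, u 0 = 0 → FinSupp u → |∑' ℓ, f ℓ * u ℓ| ≤ M * l2 (du u)

/-- the dual norm ‖f‖_{𝒰*} -/
def dualNorm (f : ℕ → ℝ) : ℝ :=
  sInf {M : ℝ | 0 ≤ M ∧ ∀ u : ℕ → ℝ, u 0 = 0 → FinSupp u →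
    |∑' ℓ, f ℓ * u ℓ| ≤ M * l2 (du u)}

/-- `g_ℓ = Σ_{k=ℓ+1}^∞ f_k`, as a limit of partial sums -/
def gOf (f : ℕ → ℝ) (ℓ : ℕ) : ℝ :=
  limUnder atTop (fun K : ℕ => ∑ k ∈ Finset.Ico (ℓ + 1) K, f k)

/-- duality pairing `⟨f, v⟩` for `v ∈ 𝒰`, extended by continuity (summation by parts) -/
def pairF (f : ℕ → ℝ) (v : ℕ → ℝ) : ℝ := ∑' ℓ, gOf f ℓ * du v ℓ

/-- partial derivatives of the bulk site potential -/
def d1V (V : ℝ → ℝ → ℝ) (r s : ℝ) : ℝ := deriv (fun t => V t s) r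
def d2V (V : ℝ → ℝ → ℝ) (r s : ℝ) : ℝ := deriv (fun t => V r t) s
def d11V (V : ℝ → ℝ → ℝ) (r s : ℝ) : ℝ := deriv (fun t => d1V V t s) r
def d12V (V : ℝ → ℝ → ℝ) (r s : ℝ) : ℝ := deriv (fun t => d1V V r t) s
def d22V (V : ℝ → ℝ → ℝ) (r s : ℝ) : ℝ := deriv (fun t => d2V V r t) s

/-- Cauchy–Born energy density `W(F) = V(F,F)` and its derivatives -/
def Wcb (V : ℝ → ℝ → ℝ) (F : ℝ) : ℝ := V F F
def dW (V : ℝ → ℝ → ℝ) (F : ℝ) : ℝ := deriv (Wcb V) F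
def d2W (V : ℝ → ℝ → ℝ) (F : ℝ) : ℝ := deriv (dW V) F

/-- standing assumptions (i)–(vi) on the site energies -/
structure SiteAssumptions (V : ℝ → ℝ → ℝ) (Vs : ℝ → ℝ) : Prop where
  smooth_V : ContDiff ℝ 3 (Function.uncurry V)
  smooth_Vs : ContDiff ℝ 3 Vs
  bdd_V : ∀ i : ℕ, i ≤ 3 → ∃ B : ℝ, ∀ p : ℝ × ℝ,
    ‖iteratedFDeriv ℝ i (Function.uncurry V) p‖ ≤ B
  bdd_Vs : ∀ i : ℕ, i ≤ 3 → ∃ B : ℝ, ∀ x : ℝ, ‖iteratedFDeriv ℝ i Vs x‖ ≤ B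
  V_zero : V 0 0 = 0
  posdef : ∀ p : ℝ × ℝ, p ≠ 0 →
    0 < d11V V 0 0 * p.1 ^ 2 + 2 * d12V V 0 0 * p.1 * p.2 + d22V V 0 0 * p.2 ^ 2
  pos_away : ∀ ε : ℝ, 0 < ε → ∃ δ : ℝ, 0 < δ ∧
    ∀ r s : ℝ, ε < Real.sqrt (r ^ 2 + s ^ 2) → δ ≤ V r s
  surf_limit : ∀ s : ℝ, Tendsto (fun r => V r s) atTop (nhds (Vs s))

/-- atomistic energy, with values in `[0,∞]` (the site energies are nonnegative
under the standing assumptions) -/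
def EaE (V : ℝ → ℝ → ℝ) (Vs : ℝ → ℝ) (u : ℕ → ℝ) : ℝ≥0∞ :=
  ENNReal.ofReal (Vs (du u 0)) +
    ∑' ℓ : ℕ, ENNReal.ofReal (V (du u ℓ) (du u (ℓ + 1)))

/-- ground state: global minimizer of the atomistic energy over 𝒰 -/
def GroundState (V : ℝ → ℝ → ℝ) (Vs : ℝ → ℝ) (u : ℕ → ℝ) : Prop :=
  memU u ∧ ∀ w : ℕ → ℝ, memU w → EaE V Vs u ≤ EaE V Vs w

/-- first variation of 𝓔ᵃ, as a function of the strain sequence `e` -/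
def fvA (V : ℝ → ℝ → ℝ) (Vs : ℝ → ℝ) (e : ℕ → ℝ) (v : ℕ → ℝ) : ℝ :=
  du v 0 * (deriv Vs (e 0) + d1V V (e 0) (e 1)) +
    ∑' ℓ : ℕ, du v (ℓ + 1) *
      (d2V V (e ℓ) (e (ℓ + 1)) + d1V V (e (ℓ + 1)) (e (ℓ + 2)))

/-- second variation (of 𝓔ᵃ, and of 𝓔^Γ) as a function of the strain sequence `e` -/
def svA (V : ℝ → ℝ → ℝ) (Vs : ℝ → ℝ) (e : ℕ → ℝ) (v : ℕ → ℝ) : ℝ :=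
  deriv (deriv Vs) (e 0) * (du v 0) ^ 2 +
    ∑' ℓ : ℕ, (d11V V (e ℓ) (e (ℓ + 1)) * (du v ℓ) ^ 2
      + 2 * d12V V (e ℓ) (e (ℓ + 1)) * du v ℓ * du v (ℓ + 1)
      + d22V V (e ℓ) (e (ℓ + 1)) * (du v (ℓ + 1)) ^ 2)

/-- a strongly stable ground state with stability constant `c` -/
def StronglyStableGS (V : ℝ → ℝ → ℝ) (Vs : ℝ → ℝ) (u : ℕ → ℝ) (c : ℝ) : Prop :=
  GroundState V Vs u ∧ 0 < c ∧
    ∀ v : ℕ → ℝ, memU v → c * ∑' ℓ, (du v ℓ) ^ 2 ≤ svA V Vs (du u) v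

/-- critical point of 𝓔ᵃ: the pointwise Euler–Lagrange equations -/
def CriticalA (V : ℝ → ℝ → ℝ) (Vs : ℝ → ℝ) (u : ℕ → ℝ) : Prop :=
  deriv Vs (du u 0) + d1V V (du u 0) (du u 1) = 0 ∧
  ∀ ℓ : ℕ, d2V V (du u ℓ) (du u (ℓ + 1)) + d1V V (du u (ℓ + 1)) (du u (ℓ + 2)) = 0

/-- first variation of the corrector energy 𝓔^Γ(·;F₀) -/
def fvG (V : ℝ → ℝ → ℝ) (Vs : ℝ → ℝ) (F0 : ℝ) (q v : ℕ → ℝ) : ℝ :=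
  du v 0 * (deriv Vs (F0 + du q 0) + d1V V (F0 + du q 0) (F0 + du q 1) - dW V F0) +
    ∑' ℓ : ℕ, du v (ℓ + 1) *
      (d2V V (F0 + du q ℓ) (F0 + du q (ℓ + 1))
        + d1V V (F0 + du q (ℓ + 1)) (F0 + du q (ℓ + 2)) - dW V F0)

/-- critical point of the corrector energy: pointwise Euler–Lagrange equations -/
def CriticalG (V : ℝ → ℝ → ℝ) (Vs : ℝ → ℝ) (F0 : ℝ) (q : ℕ → ℝ) : Prop :=
  deriv Vs (F0 + du q 0) + d1V V (F0 + du q 0) (F0 + du q 1) - dW V F0 = 0 ∧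
  ∀ ℓ : ℕ, d2V V (F0 + du q ℓ) (F0 + du q (ℓ + 1))
      + d1V V (F0 + du q (ℓ + 1)) (F0 + du q (ℓ + 2)) - dW V F0 = 0

/-- second variation of the corrector energy at `q` -/
def svG (V : ℝ → ℝ → ℝ) (Vs : ℝ → ℝ) (F0 : ℝ) (q v : ℕ → ℝ) : ℝ :=
  svA V Vs (fun ℓ => F0 + du q ℓ) v

/-- membership in 𝒬_L -/
def memQL (L : ℕ) (q : ℕ → ℝ) : Prop := memU q ∧ ∀ ℓ : ℕ, L ≤ ℓ → du q ℓ = 0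

/-- continuous piecewise affine interpolant of a lattice function -/
def fAff (f : ℕ → ℝ) (x : ℝ) : ℝ :=
  f ⌊x⌋₊ + (x - (⌊x⌋₊ : ℝ)) * (f (⌊x⌋₊ + 1) - f ⌊x⌋₊)

/-- `g̃(x) = ∫_x^∞ f(s) ds`, improper integral of the interpolant -/
def gTilde (f : ℕ → ℝ) (x : ℝ) : ℝ :=
  limUnder atTop (fun K : ℕ => ∫ t in x..(K : ℝ), fAff f t)

/-- the Cauchy–Born continuum energy of a strain field `w = ∇u`, valued in `[0,∞]` -/
def EcbE (V : ℝ → ℝ → ℝ) (w : ℝ → ℝ) : ℝ≥0∞ :=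
  ∫⁻ x in Set.Ioi (0 : ℝ), ENNReal.ofReal (Wcb V (w x))

/-- strain of the projection `Π_a u^cb`, given the gradient `w = ∇u^cb` -/
def PiA (w : ℝ → ℝ) (ℓ : ℕ) : ℝ := ∫ t in (ℓ : ℝ)..((ℓ : ℝ) + 1), w t

/-- the data of "the" strongly stable Cauchy–Born solution for the force `f`:
`w = ∇u^cb`, `w1 = ∇²u^cb`, `w2 = ∇³u^cb`, with constant `Cw` -/
def CBSolution (V : ℝ → ℝ → ℝ) (f : ℕ → ℝ) (Cw : ℝ) (w w1 w2 : ℝ → ℝ) : Prop :=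
  MemLp w 2 (volume.restrict (Set.Ioi 0)) ∧
  (∀ᵐ x ∂(volume.restrict (Set.Ioi (0 : ℝ))), dW V (w x) = gTilde f x) ∧
  (∃ ccb : ℝ, 0 < ccb ∧ ∀ vw : ℝ → ℝ, MemLp vw 2 (volume.restrict (Set.Ioi 0)) →
    ccb * ∫ x in Set.Ioi (0 : ℝ), (vw x) ^ 2 ≤
      ∫ x in Set.Ioi (0 : ℝ), d2W V (w x) * (vw x) ^ 2) ∧
  (∀ x ∈ Set.Ici (0 : ℝ), HasDerivAt w (w1 x) x) ∧
  (∀ᵐ x ∂(volume.restrict (Set.Ioi (0 : ℝ))), HasDerivAt w1 (w2 x) x) ∧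
  |w 0| ≤ Cw * dualNorm f

theorem abs_tsum_mul_le_sqrt_mul_sqrt {a b : ℕ → ℝ} (ha : Summable fun n => a n ^ 2)
    (hb : Summable fun n => b n ^ 2) :
    Summable (fun n => a n * b n) ∧
      |∑' n, a n * b n| ≤ Real.sqrt (∑' n, a n ^ 2) * Real.sqrt (∑' n, b n ^ 2) := by
  have hs : Summable (fun n => a n * b n) := by
    refine Summable.of_norm_bounded (ha.add hb) fun n => ?_
    rw [Real.norm_eq_abs, abs_le]
    constructor <;> nlinarith [sq_nonneg (a n + b n), sq_nonneg (a n - b n)]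
  refine ⟨hs, ?_⟩
  refine le_of_tendsto (hs.hasSum.tendsto_sum_nat.abs) (Eventually.of_forall fun N => ?_)
  rw [← Real.sqrt_mul (tsum_nonneg fun n => sq_nonneg _)]
  refine Real.abs_le_sqrt ((Finset.sum_mul_sq_le_sq_mul_sq _ _ _).trans ?_)
  exact mul_le_mul (ha.sum_le_tsum _ fun _ _ => sq_nonneg _)
    (hb.sum_le_tsum _ fun _ _ => sq_nonneg _) (Finset.sum_nonneg fun _ _ => sq_nonneg _)
    (tsum_nonneg fun _ => sq_nonneg _)

theorem sq_integral_unit_le_integral_sq {g : ℝ → ℝ} {a : ℝ}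
    (hg : IntervalIntegrable g volume a (a + 1))
    (hg2 : IntervalIntegrable (fun x => g x ^ 2) volume a (a + 1)) :
    (∫ x in a..(a + 1), g x) ^ 2 ≤ ∫ x in a..(a + 1), g x ^ 2 := by
  set m := ∫ x in a..(a + 1), g x with hm
  have h0 : 0 ≤ ∫ x in a..(a + 1), (g x - m) ^ 2 :=
    intervalIntegral.integral_nonneg (by linarith) fun _ _ => sq_nonneg _
  have h1 : (∫ x in a..(a + 1), (g x - m) ^ 2)
      = ∫ x in a..(a + 1), ((g x ^ 2 - (2 * m) * g x) + m ^ 2) := by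
    congr 1; ext x; ring
  rw [h1, intervalIntegral.integral_add (hg2.sub (hg.const_mul _)) (by simp),
    intervalIntegral.integral_sub hg2 (hg.const_mul _),
    intervalIntegral.integral_const_mul, ← hm] at h0
  simp at h0
  nlinarith

theorem iUnion_Ico_natCast : (⋃ n : ℕ, Set.Ico (n : ℝ) (n + 1)) = Set.Ici 0 := by
  ext x
  simp only [Set.mem_iUnion, Set.mem_Ico, Set.mem_Ici]
  constructor
  · rintro ⟨n, h1, -⟩
    exact (Nat.cast_nonneg n).trans h1
  · intro hx
    exact ⟨⌊x⌋₊, Nat.floor_le hx, Nat.lt_floor_add_one x⟩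

theorem pairwise_disjoint_Ico_natCast :
    Pairwise (Function.onFun Disjoint fun n : ℕ => Set.Ico (n : ℝ) (n + 1)) := by
  intro m n hmn
  refine Set.disjoint_left.2 fun x hm hn => hmn ?_
  have hx : 0 ≤ x := (Nat.cast_nonneg m).trans hm.1
  rw [← (Nat.floor_eq_iff hx).2 hm, ← (Nat.floor_eq_iff hx).2 hn]

theorem floor_eq_of_mem_Ico {n : ℕ} {x : ℝ} (hx : x ∈ Set.Ico (n : ℝ) (n + 1)) : ⌊x⌋₊ = n :=
  (Nat.floor_eq_iff ((Nat.cast_nonneg n).trans hx.1)).2 hx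

theorem hasSum_intervalIntegral_nat {g : ℝ → ℝ} (hg : IntegrableOn g (Set.Ioi 0)) :
    HasSum (fun n : ℕ => ∫ x in (n : ℝ)..(n + 1), g x) (∫ x in Set.Ioi (0 : ℝ), g x) := by
  rw [← integral_Ici_eq_integral_Ioi, ← iUnion_Ico_natCast]
  have := hasSum_integral_iUnion (μ := volume) (f := g)
    (s := fun n : ℕ => Set.Ico (n : ℝ) (n + 1)) (fun n => measurableSet_Ico)
    pairwise_disjoint_Ico_natCast
    (by rw [iUnion_Ico_natCast]; exact (integrableOn_Ici_iff_integrableOn_Ioi).2 hg)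
  have he : (fun n : ℕ => ∫ x in (n : ℝ)..(n + 1), g x)
      = fun n : ℕ => ∫ x in Set.Ico (n : ℝ) (n + 1), g x := by
    funext n
    rw [intervalIntegral.integral_of_le (by linarith), integral_Ico_eq_integral_Ioc]
  rw [he]
  exact this

theorem measurable_comp_floor (b : ℕ → ℝ) : Measurable fun x : ℝ => b ⌊x⌋₊ :=
  (measurable_from_top (f := b)).comp Nat.measurable_floor

theorem integrableOn_comp_floor {b : ℕ → ℝ} (hb : Summable fun n => ‖b n‖) :
    IntegrableOn (fun x : ℝ => b ⌊x⌋₊) (Set.Ioi 0) := by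
  rw [← integrableOn_Ici_iff_integrableOn_Ioi, ← iUnion_Ico_natCast]
  refine integrableOn_iUnion_of_summable_integral_norm (fun n => ?_) ?_
  · refine (integrableOn_congr_fun (g := fun _ => b n)
      (fun x hx => by simp only [floor_eq_of_mem_Ico hx]) measurableSet_Ico).2 ?_
    exact integrableOn_const (by simp)
  · convert hb using 2 with n
    rw [setIntegral_congr_fun (g := fun _ => ‖b n‖) measurableSet_Ico
      (fun x hx => by simp only [floor_eq_of_mem_Ico hx])]
    simp

theorem memLp_two_comp_floor {b : ℕ → ℝ} (hb : Summable fun n => b n ^ 2) :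
    MemLp (fun x : ℝ => b ⌊x⌋₊) 2 (volume.restrict (Set.Ioi 0)) := by
  rw [memLp_two_iff_integrable_sq (measurable_comp_floor b).aestronglyMeasurable]
  exact integrableOn_comp_floor (b := fun n => b n ^ 2) (by simpa using hb)

theorem memUstar.summable_sq {f : ℕ → ℝ} (hf : memUstar f) :
    Summable fun n => f (n + 1) ^ 2 := by
  obtain ⟨M, hM⟩ := hf
  refine summable_of_sum_range_le (c := 4 * M ^ 2) (fun n => sq_nonneg _) fun N => ?_
  set S := ∑ k ∈ Finset.range N, f (k + 1) ^ 2 with hS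
  have hS0 : 0 ≤ S := Finset.sum_nonneg fun _ _ => sq_nonneg _
  let u : ℕ → ℝ := fun k => if 1 ≤ k ∧ k ≤ N then f k else 0
  have hu0 : u 0 = 0 := by simp [u]
  have huz : ∀ k, N < k → u k = 0 := fun k hk => by
    simp only [u]; rw [if_neg (by omega)]
  have hus : ∀ k, k < N → u (k + 1) = f (k + 1) := fun k hk => by
    simp only [u]; rw [if_pos (by omega)]
  have hsum : ∀ g : ℕ → ℝ, (∀ k, N < k → g k = 0) → g 0 = 0 →
      HasSum g (∑ k ∈ Finset.range N, g (k + 1)) := by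
    intro g hg h0
    have := hasSum_sum_of_ne_finset_zero (f := g) (s := Finset.range (N + 1))
      (L := .unconditional ℕ) (fun b hb => hg b (by simpa using hb))
    rwa [Finset.sum_range_succ', h0, add_zero] at this
  have h1 : ∑' k, f k * u k = S := by
    rw [(hsum (fun k => f k * u k) (fun k hk => by simp [huz k hk]) (by simp [hu0])).tsum_eq]
    refine Finset.sum_congr rfl fun k hk => ?_
    rw [hus k (Finset.mem_range.1 hk), sq]
  have hu2 : HasSum (fun k => u k ^ 2) S := by
    convert hsum (fun k => u k ^ 2) (fun k hk => by simp [huz k hk]) (by simp [hu0]) using 1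
    refine Finset.sum_congr rfl fun k hk => ?_
    rw [hus k (Finset.mem_range.1 hk)]
  have hu2' : HasSum (fun k => u (k + 1) ^ 2) S := by
    have := (hasSum_nat_add_iff' (f := fun k => u k ^ 2) 1).2 hu2
    simpa [hu0] using this
  have hle : ∀ k, du u k ^ 2 ≤ 2 * u (k + 1) ^ 2 + 2 * u k ^ 2 := fun k => by
    unfold du; nlinarith [sq_nonneg (u (k + 1) + u k)]
  have hd : ∑' k, du u k ^ 2 ≤ 4 * S := by
    have hb := (hu2'.mul_left 2).add (hu2.mul_left 2)
    have := Summable.tsum_le_tsum hle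
      (Summable.of_nonneg_of_le (fun _ => sq_nonneg _) hle hb.summable) hb.summable
    rw [hb.tsum_eq] at this
    linarith
  have h2 := hM u hu0 ⟨N + 1, fun k hk => huz k hk⟩
  rw [h1, abs_of_nonneg hS0] at h2
  have h3 : S ^ 2 ≤ M ^ 2 * (4 * S) := by
    calc S ^ 2 ≤ (M * l2 (du u)) ^ 2 := pow_le_pow_left₀ hS0 h2 2
      _ = M ^ 2 * ∑' k, du u k ^ 2 := by
        rw [mul_pow, l2, Real.sq_sqrt (tsum_nonneg fun _ => sq_nonneg _)]
      _ ≤ _ := by gcongr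
  rcases hS0.eq_or_lt with h | h
  · rw [← h]; positivity
  · nlinarith

theorem measurable_fAff (f : ℕ → ℝ) : Measurable (fAff f) :=
  (measurable_comp_floor f).add ((measurable_id.sub (measurable_comp_floor fun n => (n : ℝ))).mul
    (measurable_comp_floor fun n => f (n + 1) - f n))

theorem abs_fAff_le (f : ℕ → ℝ) {x : ℝ} (hx : 0 ≤ x) :
    |fAff f x| ≤ |f ⌊x⌋₊| + |f (⌊x⌋₊ + 1)| := by
  have h0 := Nat.floor_le hx
  have h1 := Nat.lt_floor_add_one x
  have : fAff f x = (1 - (x - ⌊x⌋₊)) * f ⌊x⌋₊ + (x - ⌊x⌋₊) * f (⌊x⌋₊ + 1) := by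
    unfold fAff; ring
  rw [this]
  refine (abs_add_le _ _).trans ?_
  rw [abs_mul, abs_mul, abs_of_nonneg (by linarith : (0:ℝ) ≤ 1 - (x - ⌊x⌋₊)),
    abs_of_nonneg (by linarith : (0:ℝ) ≤ x - ⌊x⌋₊)]
  gcongr
  · exact mul_le_of_le_one_left (abs_nonneg _) (by linarith)
  · exact mul_le_of_le_one_left (abs_nonneg _) (by linarith)

theorem exists_abs_le_of_summable_sq {f : ℕ → ℝ} (hf : Summable fun n => f n ^ 2) :
    ∃ K, ∀ n, |f n| ≤ K := by
  refine ⟨Real.sqrt (∑' n, f n ^ 2), fun n => Real.abs_le_sqrt ?_⟩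
  exact hf.le_tsum n fun _ _ => sq_nonneg _

theorem intervalIntegrable_fAff {f : ℕ → ℝ} (hf : Summable fun n => f n ^ 2) {a b : ℝ}
    (ha : 0 ≤ a) (hb : 0 ≤ b) : IntervalIntegrable (fAff f) volume a b := by
  obtain ⟨K, hK⟩ := exists_abs_le_of_summable_sq hf
  refine (intervalIntegrable_const (c := 2 * K)).mono_fun'
    (measurable_fAff f).aestronglyMeasurable ?_
  refine (ae_restrict_iff' measurableSet_uIoc).2 (Eventually.of_forall fun x hx => ?_)
  have hx0 : 0 ≤ x := (le_min ha hb).trans hx.1.le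
  have := abs_fAff_le f hx0
  have h1 := hK ⌊x⌋₊
  have h2 := hK (⌊x⌋₊ + 1)
  simp only [Real.norm_eq_abs]
  linarith

theorem continuousWithinAt_fAff (f : ℕ → ℝ) {x : ℝ} (hx : 0 ≤ x) :
    ContinuousWithinAt (fAff f) (Set.Ici x) x := by
  have hc : ContinuousWithinAt (fun y : ℝ => f ⌊x⌋₊ + (y - (⌊x⌋₊ : ℝ)) *
      (f (⌊x⌋₊ + 1) - f ⌊x⌋₊)) (Set.Ici x) x := by fun_prop
  refine hc.congr_of_eventuallyEq ?_ rfl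
  have : Set.Ico x (⌊x⌋₊ + 1 : ℝ) ∈ nhdsWithin x (Set.Ici x) :=
    Ico_mem_nhdsGE (Nat.lt_floor_add_one x)
  filter_upwards [this] with y hy
  have : ⌊y⌋₊ = ⌊x⌋₊ := floor_eq_of_mem_Ico ⟨(Nat.floor_le hx).trans hy.1, hy.2⟩
  simp only [fAff, this]

theorem integrableOn_fAff_pow_four {f : ℕ → ℝ} (hf : Summable fun n => f n ^ 2) :
    IntegrableOn (fun x => fAff f x ^ 4) (Set.Ioi 0) := by
  obtain ⟨K, hK⟩ := exists_abs_le_of_summable_sq hf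
  have hs : Summable fun n => 8 * K ^ 2 * (f n ^ 2 + f (n + 1) ^ 2) :=
    (hf.add ((summable_nat_add_iff 1).2 hf)).mul_left _
  refine Integrable.mono' (integrableOn_comp_floor hs.norm)
    ((measurable_fAff f).pow_const 4).aestronglyMeasurable ?_
  refine (ae_restrict_iff' measurableSet_Ioi).2 (Eventually.of_forall fun x hx => ?_)
  have h0 := abs_fAff_le f (le_of_lt hx)
  have h1 := hK ⌊x⌋₊
  have h2 := hK (⌊x⌋₊ + 1)
  set p := |f ⌊x⌋₊| with hp
  set q := |f (⌊x⌋₊ + 1)| with hq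
  have hp0 : 0 ≤ p := abs_nonneg _
  have hq0 : 0 ≤ q := abs_nonneg _
  rw [norm_pow, Real.norm_eq_abs, ← sq_abs (f ⌊x⌋₊), ← sq_abs (f (⌊x⌋₊ + 1)), ← hp, ← hq]
  have hA : (p + q) ^ 2 ≤ 4 * K ^ 2 := by nlinarith
  have hB : (p + q) ^ 2 ≤ 2 * (p ^ 2 + q ^ 2) := by nlinarith [sq_nonneg (p - q)]
  calc |fAff f x| ^ 4 ≤ (p + q) ^ 4 := pow_le_pow_left₀ (abs_nonneg _) h0 4
    _ = (p + q) ^ 2 * (p + q) ^ 2 := by ring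
    _ ≤ (4 * K ^ 2) * (2 * (p ^ 2 + q ^ 2)) := by gcongr
    _ = _ := by ring

theorem gTilde_eq_or_const {f : ℕ → ℝ} (hf : Summable fun n => f n ^ 2) :
    (∃ c, ∀ x, 0 < x → gTilde f x = c - ∫ t in (1 : ℝ)..x, fAff f t) ∨
      ∃ c, ∀ x, 0 < x → gTilde f x = c := by
  have hadd : ∀ x, 0 ≤ x → ∀ y, 0 ≤ y → ∀ K : ℕ, (∫ t in x..(K : ℝ), fAff f t)
      = (∫ t in x..y, fAff f t) + ∫ t in y..(K : ℝ), fAff f t := fun x hx y hy K =>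
    (intervalIntegral.integral_add_adjacent_intervals (intervalIntegrable_fAff hf hx hy)
      (intervalIntegrable_fAff hf hy (Nat.cast_nonneg K))).symm
  by_cases h : ∃ l, Tendsto (fun K : ℕ => ∫ t in (1 : ℝ)..(K : ℝ), fAff f t) atTop (nhds l)
  · obtain ⟨l, hl⟩ := h
    refine Or.inl ⟨l, fun x hx => ?_⟩
    refine Tendsto.limUnder_eq ?_
    simp_rw [hadd x hx.le 1 zero_le_one]
    rw [intervalIntegral.integral_symm x 1, sub_neg_eq_add, add_comm]
    exact hl.const_add _
  · refine Or.inr ⟨Classical.epsilon fun _ : ℝ => False, fun x hx => ?_⟩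
    unfold gTilde limUnder lim
    congr 1
    funext l
    refine eq_false fun hl => h ⟨(∫ t in (1 : ℝ)..x, fAff f t) + l, ?_⟩
    simp_rw [hadd 1 zero_le_one x hx.le]
    exact Tendsto.const_add _ hl

theorem SiteAssumptions.contDiff_Wcb {V : ℝ → ℝ → ℝ} {Vs : ℝ → ℝ} (h : SiteAssumptions V Vs) :
    ContDiff ℝ 3 (Wcb V) :=
  h.smooth_V.comp (contDiff_id.prodMk contDiff_id)

theorem SiteAssumptions.exists_bound_iteratedDeriv_Wcb {V : ℝ → ℝ → ℝ} {Vs : ℝ → ℝ}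
    (h : SiteAssumptions V Vs) {i : ℕ} (hi : i ≤ 3) :
    ∃ B, ∀ x, |iteratedDeriv i (Wcb V) x| ≤ B := by
  obtain ⟨B, hB⟩ := h.bdd_V i hi
  let L : ℝ →L[ℝ] ℝ × ℝ := (ContinuousLinearMap.id ℝ ℝ).prod (ContinuousLinearMap.id ℝ ℝ)
  have hL : Wcb V = Function.uncurry V ∘ L := rfl
  refine ⟨B * ∏ _j : Fin i, ‖L‖, fun x => ?_⟩
  rw [← Real.norm_eq_abs, ← norm_iteratedFDeriv_eq_norm_iteratedDeriv, hL,
    L.iteratedFDeriv_comp_right h.smooth_V x (by exact_mod_cast hi)]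
  refine (ContinuousMultilinearMap.norm_compContinuousLinearMap_le _ _).trans ?_
  exact mul_le_mul_of_nonneg_right (hB _) (by positivity)

theorem SiteAssumptions.dW_zero {V : ℝ → ℝ → ℝ} {Vs : ℝ → ℝ} (h : SiteAssumptions V Vs) :
    dW V 0 = 0 := by
  refine IsLocalMin.deriv_eq_zero (Eventually.of_forall fun x => ?_)
  simp only [Wcb, h.V_zero]
  rcases eq_or_ne x 0 with rfl | hx
  · exact h.V_zero.ge
  · have hpos : 0 < Real.sqrt (x ^ 2 + x ^ 2) := Real.sqrt_pos.2 (by positivity)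
    obtain ⟨δ, hδ, hV⟩ := h.pos_away _ (half_pos hpos)
    exact hδ.le.trans (hV x x (half_lt_self hpos))

theorem SiteAssumptions.hasDerivAt_dW {V : ℝ → ℝ → ℝ} {Vs : ℝ → ℝ} (h : SiteAssumptions V Vs)
    (x : ℝ) : HasDerivAt (dW V) (d2W V x) x := by
  have h1 : ContDiff ℝ 2 (deriv (Wcb V)) :=
    ((contDiff_succ_iff_deriv (n := 2)).1 (by rw [two_add_one_eq_three]; exact h.contDiff_Wcb)).2.2
  exact (h1.differentiable (by norm_num) x).hasDerivAt

theorem SiteAssumptions.contDiff_d2W {V : ℝ → ℝ → ℝ} {Vs : ℝ → ℝ} (h : SiteAssumptions V Vs) :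
    ContDiff ℝ 1 (d2W V) := by
  have h1 : ContDiff ℝ 2 (deriv (Wcb V)) :=
    ((contDiff_succ_iff_deriv (n := 2)).1 (by rw [two_add_one_eq_three]; exact h.contDiff_Wcb)).2.2
  exact ((contDiff_succ_iff_deriv (n := 1)).1 (by rw [one_add_one_eq_two]; exact h1)).2.2

theorem SiteAssumptions.exists_abs_dW_le {V : ℝ → ℝ → ℝ} {Vs : ℝ → ℝ}
    (h : SiteAssumptions V Vs) : ∃ B, ∀ x, |dW V x| ≤ B * |x| := by
  obtain ⟨B, hB⟩ := h.exists_bound_iteratedDeriv_Wcb (i := 2) (by norm_num)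
  refine ⟨B, fun x => ?_⟩
  have := convex_univ.norm_image_sub_le_of_norm_hasDerivWithin_le (f := dW V) (C := B)
    (fun y _ => (h.hasDerivAt_dW y).hasDerivWithinAt)
    (fun y _ => by
      have := hB y
      rwa [iteratedDeriv_succ, iteratedDeriv_one] at this) (Set.mem_univ 0) (Set.mem_univ x)
  simpa [h.dW_zero] using this

theorem SiteAssumptions.exists_taylor_bound_dW {V : ℝ → ℝ → ℝ} {Vs : ℝ → ℝ}
    (h : SiteAssumptions V Vs) :
    ∃ B, 0 < B ∧ ∀ x y, |dW V y - dW V x - d2W V x * (y - x)| ≤ B * (y - x) ^ 2 := by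
  obtain ⟨B, hB⟩ := h.exists_bound_iteratedDeriv_Wcb (i := 3) le_rfl
  have hlip : ∀ x y, |d2W V y - d2W V x| ≤ B * |y - x| := fun x y =>
    convex_univ.norm_image_sub_le_of_norm_hasDerivWithin_le (f := d2W V) (C := B)
      (fun z _ => ((h.contDiff_d2W.differentiable (by norm_num)) z).hasDerivAt.hasDerivWithinAt)
      (fun z _ => by
        have := hB z
        rwa [iteratedDeriv_succ, iteratedDeriv_succ, iteratedDeriv_one] at this)
      (Set.mem_univ x) (Set.mem_univ y)
  have hB0 : 0 ≤ B := (abs_nonneg _).trans (hB 0)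
  refine ⟨B + 1, by linarith, fun x y => ?_⟩
  have := (convex_uIcc x y).norm_image_sub_le_of_norm_hasDerivWithin_le
    (f := fun z => dW V z - d2W V x * z) (f' := fun z => d2W V z - d2W V x) (C := B * |y - x|)
    (fun z _ => by
      have := (h.hasDerivAt_dW z).sub ((hasDerivAt_id z).const_mul (d2W V x))
      rw [mul_one] at this
      exact this.hasDerivWithinAt)
    (fun z hz => (hlip x z).trans
      (mul_le_mul_of_nonneg_left (Set.abs_sub_left_of_mem_uIcc hz) hB0))
    Set.left_mem_uIcc Set.right_mem_uIcc
  rw [Real.norm_eq_abs, Real.norm_eq_abs, mul_assoc, abs_mul_abs_self] at this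
  calc _ = |dW V y - d2W V x * y - (dW V x - d2W V x * x)| := by congr 1; ring
    _ ≤ _ := this
    _ ≤ _ := by nlinarith [sq_nonneg (y - x)]

theorem le_of_stability {ψ : ℝ → ℝ} (hψ : ContinuousOn ψ (Set.Ioi 0)) {c : ℝ}
    (hst : ∀ v : ℝ → ℝ, MemLp v 2 (volume.restrict (Set.Ioi 0)) →
      c * ∫ x in Set.Ioi (0 : ℝ), v x ^ 2 ≤ ∫ x in Set.Ioi (0 : ℝ), ψ x * v x ^ 2)
    {x : ℝ} (hx : 0 < x) : c ≤ ψ x := by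
  by_contra! hlt
  obtain ⟨m, hm1, hm2⟩ := exists_between hlt
  have hev : ∀ᶠ y in nhds x, ψ y < m ∧ 0 < y :=
    ((hψ.continuousAt (Ioi_mem_nhds hx)).eventually_lt_const hm1).and (lt_mem_nhds hx)
  obtain ⟨δ, hδ, hball⟩ := Metric.eventually_nhds_iff_ball.1 hev
  set s := Set.Icc x (x + δ / 2) with hs
  have hsub : ∀ y ∈ s, ψ y < m ∧ 0 < y := fun y hy => hball y (by
    rw [Metric.mem_ball, Real.dist_eq, abs_of_nonneg (by linarith [hy.1])]; linarith [hy.2])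
  have hs0 : s ⊆ Set.Ioi 0 := fun y hy => (hsub y hy).2
  have hvol : volume.real s = δ / 2 := by
    rw [hs, Real.volume_real_Icc_of_le (by linarith)]; ring
  have hmem : MemLp (s.indicator fun _ => (1 : ℝ)) 2 (volume.restrict (Set.Ioi 0)) :=
    memLp_indicator_const 2 measurableSet_Icc 1 (Or.inr (by
      rw [Measure.restrict_apply measurableSet_Icc]
      exact (measure_mono Set.inter_subset_left |>.trans_lt measure_Icc_lt_top).ne))
  have key := hst _ hmem
  have e1 : (∫ y in Set.Ioi (0 : ℝ), s.indicator (fun _ => (1 : ℝ)) y ^ 2) = δ / 2 := by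
    have : (fun y => s.indicator (fun _ => (1 : ℝ)) y ^ 2) = s.indicator fun _ => (1 : ℝ) := by
      ext y; by_cases hy : y ∈ s <;> simp [hy]
    rw [this, setIntegral_indicator measurableSet_Icc, Set.inter_eq_self_of_subset_right hs0]
    simp [hvol]
  have e2 : (∫ y in Set.Ioi (0 : ℝ), ψ y * s.indicator (fun _ => (1 : ℝ)) y ^ 2)
      = ∫ y in s, ψ y := by
    have : (fun y => ψ y * s.indicator (fun _ => (1 : ℝ)) y ^ 2) = s.indicator ψ := by
      ext y; by_cases hy : y ∈ s <;> simp [hy]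
    rw [this, setIntegral_indicator measurableSet_Icc, Set.inter_eq_self_of_subset_right hs0]
  have e3 : (∫ y in s, ψ y) ≤ ∫ _ in s, m :=
    setIntegral_mono_on ((hψ.mono hs0).integrableOn_compact isCompact_Icc)
      (integrableOn_const measure_Icc_lt_top.ne) measurableSet_Icc
      fun y hy => (hsub y hy).1.le
  rw [e1, e2] at key
  simp [hvol] at e3
  nlinarith

theorem CBSolution.integrableOn_pow_four {V : ℝ → ℝ → ℝ} {Vs : ℝ → ℝ} {f : ℕ → ℝ} {Cw : ℝ}
    {w w1 w2 : ℝ → ℝ} (h : SiteAssumptions V Vs) (hf : memUstar f)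
    (hw : CBSolution V f Cw w w1 w2) : IntegrableOn (fun x => w1 x ^ 4) (Set.Ioi 0) := by
  obtain ⟨-, hEL, ⟨c, hc, hst⟩, hd, -, -⟩ := hw
  have hf2 : Summable fun n => f n ^ 2 := (summable_nat_add_iff 1).1 hf.summable_sq
  have hwc : ContinuousOn w (Set.Ioi 0) := fun x hx =>
    (hd x (Set.Ioi_subset_Ici_self hx)).continuousAt.continuousWithinAt
  have hlow : ∀ x, 0 < x → c ≤ d2W V (w x) := fun x hx =>
    le_of_stability (ψ := fun x => d2W V (w x))
      (h.contDiff_d2W.continuous.comp_continuousOn hwc) hst hx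
  have hdF : ∀ x, 0 < x → HasDerivAt (fun y => dW V (w y)) (d2W V (w x) * w1 x) x :=
    fun x hx => (h.hasDerivAt_dW (w x)).comp x (hd x hx.le)
  have heq : ∀ G : ℝ → ℝ, ContinuousOn G (Set.Ioi 0) → (∀ x, 0 < x → gTilde f x = G x) →
      ∀ x, 0 < x → dW V (w x) = G x := by
    intro G hG hgG x hx
    refine Measure.eqOn_open_of_ae_eq (μ := volume) (U := Set.Ioi (0 : ℝ)) ?_ isOpen_Ioi
      (fun y hy => (hdF y hy).continuousAt.continuousWithinAt) hG hx
    filter_upwards [hEL, ae_restrict_mem measurableSet_Ioi] with y hy hy0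
    rw [hy, hgG y hy0]
  have hder : ∀ (G : ℝ → ℝ) (x G' : ℝ), 0 < x → (∀ y, 0 < y → dW V (w y) = G y) →
      HasDerivWithinAt G G' (Set.Ici x) x → d2W V (w x) * w1 x = G' := by
    intro G x G' hx hG hG'
    have h1 := (hdF x hx).hasDerivWithinAt (s := Set.Ici x)
    have h2 : HasDerivWithinAt (fun y => dW V (w y)) G' (Set.Ici x) x :=
      hG'.congr (fun y hy => hG y (hx.trans_le hy)) (hG x hx)
    exact (uniqueDiffOn_Ici x x Set.self_mem_Ici).eq_deriv _ h1 h2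
  have hbound : ∀ x, 0 < x → |d2W V (w x) * w1 x| ≤ |fAff f x| := by
    intro x hx
    rcases gTilde_eq_or_const hf2 with ⟨a, ha⟩ | ⟨a, ha⟩
    · have hF : ∀ y, 0 < y → HasDerivWithinAt (fun x => a - ∫ t in (1 : ℝ)..x, fAff f t)
          (-fAff f y) (Set.Ici y) y := fun y hy => by
        refine HasDerivWithinAt.const_sub a ?_
        exact intervalIntegral.integral_hasDerivWithinAt_right
          (intervalIntegrable_fAff hf2 zero_le_one hy.le)
          ((measurable_fAff f).stronglyMeasurable.stronglyMeasurableAtFilter)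
          ((continuousWithinAt_fAff f hy.le).mono Set.Ioi_subset_Ici_self)
      have hG : ContinuousOn (fun x => a - ∫ t in (1 : ℝ)..x, fAff f t) (Set.Ioi 0) := by
        refine continuousOn_const.sub fun y hy => ?_
        have hy0 : 0 < y := hy
        have := intervalIntegral.continuousOn_primitive_interval'
          (μ := volume) (f := fAff f) (a := 1) (b₁ := 0) (b₂ := y + 2)
          (intervalIntegrable_fAff hf2 le_rfl (by linarith))
          (by rw [Set.uIcc_of_le (by linarith)]; constructor <;> linarith)
        refine (this.continuousAt ?_).continuousWithinAt
        rw [Set.uIcc_of_le (by linarith)]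
        exact Icc_mem_nhds hy0 (by linarith)
      rw [hder _ x _ hx (heq _ hG ha) (hF x hx), abs_neg]
    · rw [hder (fun _ => a) x 0 hx (heq _ continuousOn_const ha) (hasDerivWithinAt_const _ _ _),
        abs_zero]
      exact abs_nonneg _
  have hmeas : AEStronglyMeasurable (fun x => w1 x ^ 4) (volume.restrict (Set.Ioi 0)) := by
    refine ((measurable_deriv w).pow_const 4).aestronglyMeasurable.congr ?_
    filter_upwards [ae_restrict_mem measurableSet_Ioi] with y hy
    rw [(hd y (Set.Ioi_subset_Ici_self hy)).deriv]
  refine Integrable.mono' ((integrableOn_fAff_pow_four hf2).const_mul (c⁻¹ ^ 4)) hmeas ?_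
  refine (ae_restrict_iff' measurableSet_Ioi).2 (Eventually.of_forall fun x hx => ?_)
  have h1 : c * |w1 x| ≤ |fAff f x| := by
    refine le_trans ?_ (hbound x hx)
    rw [abs_mul]
    gcongr
    exact (hlow x hx).trans (le_abs_self _)
  have h2 : |w1 x| ≤ c⁻¹ * |fAff f x| := by
    rwa [← div_eq_inv_mul, le_div_iff₀' hc]
  rw [norm_pow, Real.norm_eq_abs, ← (by decide : Even 4).pow_abs (fAff f x), ← mul_pow]
  exact pow_le_pow_left₀ (abs_nonneg _) h2 4

theorem abs_sub_integral_unit_le {w w1 : ℝ → ℝ} {a : ℝ}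
    (hd : ∀ x ∈ Set.Icc a (a + 1), HasDerivAt w (w1 x) x)
    (hi : IntervalIntegrable w1 volume a (a + 1)) {x : ℝ} (hx : x ∈ Set.Icc a (a + 1)) :
    |w x - ∫ t in a..(a + 1), w t| ≤ ∫ t in a..(a + 1), |w1 t| := by
  have hcont : ContinuousOn w (Set.uIcc a (a + 1)) := by
    rw [Set.uIcc_of_le (by linarith)]
    exact fun y hy => (hd y hy).continuousAt.continuousWithinAt
  have hpt : ∀ t ∈ Set.Icc a (a + 1), |w x - w t| ≤ ∫ t in a..(a + 1), |w1 t| := by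
    intro t ht
    have hsub : Set.uIcc t x ⊆ Set.uIcc a (a + 1) := by
      rw [Set.uIcc_of_le (by linarith : a ≤ a + 1)]
      exact Set.ordConnected_Icc.uIcc_subset ht hx
    rw [← intervalIntegral.integral_eq_sub_of_hasDerivAt (fun y hy => hd y (by
      have := hsub hy; rwa [Set.uIcc_of_le (by linarith)] at this)) (hi.mono_set hsub)]
    rw [← Real.norm_eq_abs]
    refine intervalIntegral.norm_integral_le_integral_norm_uIoc.trans ?_
    rw [intervalIntegral.integral_of_le (by linarith)]
    refine setIntegral_mono_set ?_ (Eventually.of_forall fun _ => abs_nonneg _) ?_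
    · exact hi.1.abs
    · refine LE.le.eventuallyLE ?_
      have := Set.uIoc_subset_uIoc_of_uIcc_subset_uIcc hsub
      rwa [Set.uIoc_of_le (by linarith : a ≤ a + 1)] at this
  have hs : w x - ∫ t in a..(a + 1), w t = ∫ t in a..(a + 1), (w x - w t) := by
    rw [intervalIntegral.integral_sub (by simp) hcont.intervalIntegrable]
    simp
  rw [hs]
  have := intervalIntegral.norm_integral_le_of_norm_le_const (f := fun t => w x - w t)
    (a := a) (b := a + 1) (C := ∫ t in a..(a + 1), |w1 t|) fun t ht => hpt t (by
      rw [Set.uIoc_of_le (by linarith)] at ht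
      exact Set.Ioc_subset_Icc_self ht)
  simpa using this

theorem sq_integral_unit_sub_le {φ φ' w w1 : ℝ → ℝ} {a B : ℝ} (hφ : Continuous φ)
    (hB : ∀ x y, |φ y - φ x - φ' x * (y - x)| ≤ B * (y - x) ^ 2)
    (hd : ∀ x ∈ Set.Icc a (a + 1), HasDerivAt w (w1 x) x)
    (h4 : IntervalIntegrable (fun x => w1 x ^ 4) volume a (a + 1)) :
    ((∫ x in a..(a + 1), φ (w x)) - φ (∫ x in a..(a + 1), w x)) ^ 2
      ≤ B ^ 2 * ∫ x in a..(a + 1), w1 x ^ 4 := by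
  have hB0 : 0 ≤ B := by simpa using (abs_nonneg _).trans (hB 0 1)
  have hIoc : Set.uIoc a (a + 1) = Set.Ioc a (a + 1) := Set.uIoc_of_le (by linarith)
  have hmeas : AEStronglyMeasurable w1 (volume.restrict (Set.uIoc a (a + 1))) := by
    refine (measurable_deriv w).aestronglyMeasurable.congr ?_
    filter_upwards [ae_restrict_mem measurableSet_uIoc] with y hy
    exact (hd y (Set.Ioc_subset_Icc_self (hIoc ▸ hy))).deriv
  have h2 : IntervalIntegrable (fun x => w1 x ^ 2) volume a (a + 1) := by
    refine (h4.add (intervalIntegrable_const (c := (1 : ℝ)))).mono_fun' (hmeas.pow 2)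
      (Eventually.of_forall fun x => ?_)
    simp only [norm_pow, Real.norm_eq_abs, sq_abs]
    nlinarith [sq_nonneg (w1 x ^ 2 - 1)]
  have h1 : IntervalIntegrable w1 volume a (a + 1) := by
    refine (h2.add (intervalIntegrable_const (c := (1 : ℝ)))).mono_fun' hmeas
      (Eventually.of_forall fun x => ?_)
    simp only [Real.norm_eq_abs]
    nlinarith [sq_nonneg (|w1 x| - 1), sq_abs (w1 x)]
  set I := ∫ t in a..(a + 1), |w1 t| with hI
  set m := ∫ t in a..(a + 1), w t with hm
  have hI2 : I ^ 2 ≤ ∫ t in a..(a + 1), w1 t ^ 2 := by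
    simpa using sq_integral_unit_le_integral_sq h1.abs (by simpa using h2)
  have hI4 : (I ^ 2) ^ 2 ≤ ∫ t in a..(a + 1), w1 t ^ 4 := by
    refine (pow_le_pow_left₀ (sq_nonneg _) hI2 2).trans ?_
    have := sq_integral_unit_le_integral_sq h2 (by simpa [← pow_mul] using h4)
    simpa [← pow_mul] using this
  have hcont : ContinuousOn w (Set.uIcc a (a + 1)) := by
    rw [Set.uIcc_of_le (by linarith)]
    exact fun y hy => (hd y hy).continuousAt.continuousWithinAt
  have hwi := hcont.intervalIntegrable (μ := volume)
  have hφi : IntervalIntegrable (fun x => φ (w x)) volume a (a + 1) :=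
    (hφ.comp_continuousOn hcont).intervalIntegrable
  have heq : (∫ x in a..(a + 1), φ (w x)) - φ m
      = ∫ x in a..(a + 1), (φ (w x) - φ m - φ' m * (w x - m)) := by
    rw [intervalIntegral.integral_sub (hφi.sub intervalIntegrable_const)
      ((hwi.sub intervalIntegrable_const).const_mul _),
      intervalIntegral.integral_sub hφi intervalIntegrable_const,
      intervalIntegral.integral_const_mul,
      intervalIntegral.integral_sub hwi intervalIntegrable_const, ← hm]
    simp
  have hle : |(∫ x in a..(a + 1), φ (w x)) - φ m| ≤ B * I ^ 2 := by
    rw [heq]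
    have := intervalIntegral.norm_integral_le_of_norm_le_const
      (f := fun x => φ (w x) - φ m - φ' m * (w x - m))
      (a := a) (b := a + 1) (C := B * I ^ 2) fun x hx => by
        refine (hB m (w x)).trans (mul_le_mul_of_nonneg_left ?_ hB0)
        exact sq_le_sq' (abs_le.1 (abs_sub_integral_unit_le hd h1
          (Set.Ioc_subset_Icc_self (hIoc ▸ hx)))).1
          (abs_le.1 (abs_sub_integral_unit_le hd h1 (Set.Ioc_subset_Icc_self (hIoc ▸ hx)))).2
    simpa using this
  calc _ ≤ (B * I ^ 2) ^ 2 := sq_le_sq' (abs_le.1 hle).1 (abs_le.1 hle).2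
    _ = B ^ 2 * (I ^ 2) ^ 2 := by ring
    _ ≤ _ := by gcongr

/-- discretization error of the Cauchy–Born model: comparing
`∫₀^∞ ∂_F W(∇u^cb) ∇v dx` (with `v` identified with its piecewise affine
interpolant, so `∇v = v'_ℓ` on `(ℓ, ℓ+1)`) with the discrete sum
`Σ_ℓ ∂_F W((Π_a u^cb)'_ℓ) v'_ℓ`. -/
theorem cb_discretization_estimate (V : ℝ → ℝ → ℝ) (Vs : ℝ → ℝ)
    (h : SiteAssumptions V Vs) (Cw : ℝ) (hCw : 0 < Cw) :
    ∃ εcb C : ℝ, 0 < εcb ∧ 0 < C ∧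
      ∀ f : ℕ → ℝ, memUstar f → dualNorm f < εcb →
      ∀ w w1 w2 : ℝ → ℝ, CBSolution V f Cw w w1 w2 →
      ∀ v : ℕ → ℝ, memU v →
        |(∫ x in Set.Ioi (0 : ℝ), dW V (w x) * du v ⌊x⌋₊)
            - ∑' ℓ : ℕ, dW V (PiA w ℓ) * du v ℓ| ≤
          C * Real.sqrt (∫ x in Set.Ioi (0 : ℝ), (w1 x) ^ 4) * l2 (du v) := by
  obtain ⟨B, hB, hT⟩ := h.exists_taylor_bound_dW
  obtain ⟨A, hA⟩ := h.exists_abs_dW_le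
  refine ⟨1, B, one_pos, hB, fun f hf _ w w1 w2 hw v hv => ?_⟩
  have h4 := hw.integrableOn_pow_four h hf
  obtain ⟨hw2, -, -, hd, -, -⟩ := hw
  have hdWc : Continuous (dW V) :=
    continuous_iff_continuousAt.2 fun x => (h.hasDerivAt_dW x).continuousAt
  have hdW2 : MemLp (fun x => dW V (w x)) 2 (volume.restrict (Set.Ioi 0)) :=
    hw2.of_le_mul (hdWc.comp_aestronglyMeasurable hw2.1) (Eventually.of_forall fun x => hA (w x))
  have hint : IntegrableOn (fun x => dW V (w x) * du v ⌊x⌋₊) (Set.Ioi 0) :=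
    hdW2.integrable_mul (memLp_two_comp_floor hv.2)
  have hS1 : HasSum (fun n : ℕ => (∫ x in (n : ℝ)..(n + 1), dW V (w x)) * du v n)
      (∫ x in Set.Ioi (0 : ℝ), dW V (w x) * du v ⌊x⌋₊) := by
    convert hasSum_intervalIntegral_nat hint using 2 with n
    rw [← intervalIntegral.integral_mul_const, intervalIntegral.integral_of_le (by linarith),
      intervalIntegral.integral_of_le (by linarith), ← integral_Ico_eq_integral_Ioc,
      ← integral_Ico_eq_integral_Ioc]
    exact setIntegral_congr_fun measurableSet_Ico fun x hx => by
      simp only [floor_eq_of_mem_Ico hx]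
  have hS4 := hasSum_intervalIntegral_nat h4
  set a : ℕ → ℝ := fun n => (∫ x in (n : ℝ)..(n + 1), dW V (w x)) - dW V (PiA w n) with ha
  have hale : ∀ n, a n ^ 2 ≤ B ^ 2 * ∫ x in (n : ℝ)..(n + 1), w1 x ^ 4 := fun n =>
    sq_integral_unit_sub_le hdWc hT
      (fun x hx => hd x ((Nat.cast_nonneg n).trans hx.1))
      ((intervalIntegrable_iff_integrableOn_Ioc_of_le (by linarith)).2
        (h4.mono_set fun x hx => (Nat.cast_nonneg n).trans_lt hx.1))
  have hsa : Summable fun n => a n ^ 2 :=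
    Summable.of_nonneg_of_le (fun _ => sq_nonneg _) hale (hS4.mul_left _).summable
  have hta : ∑' n, a n ^ 2 ≤ B ^ 2 * ∫ x in Set.Ioi (0 : ℝ), w1 x ^ 4 :=
    hasSum_le hale hsa.hasSum (hS4.mul_left _)
  obtain ⟨hsum, hCS⟩ := abs_tsum_mul_le_sqrt_mul_sqrt hsa hv.2
  have hS2 : HasSum (fun n => dW V (PiA w n) * du v n)
      ((∫ x in Set.Ioi (0 : ℝ), dW V (w x) * du v ⌊x⌋₊) - ∑' n, a n * du v n) := by
    have he : (fun n => dW V (PiA w n) * du v n) = fun n : ℕ =>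
        (∫ x in (n : ℝ)..(n + 1), dW V (w x)) * du v n - a n * du v n := by
      funext n
      simp only [ha]
      ring
    rw [he]
    exact hS1.sub hsum.hasSum
  rw [hS2.tsum_eq, sub_sub_cancel]
  refine hCS.trans (mul_le_mul_of_nonneg_right ?_ (Real.sqrt_nonneg _))
  refine (Real.sqrt_le_sqrt hta).trans_eq ?_
  rw [Real.sqrt_mul (sq_nonneg _), Real.sqrt_sq hB.le]

end
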